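/- For all real numbers b > 0 and c > 0, the integral ∫₀^∞ η³(i·4x/π) · e^{-b²x} · cos(cx) dx equals (π/4) · cosh((π/2)A(b,c)) · cos((π/2)B(b,c)) / ( cosh²((π/2)A(b,c)) − sin²((π/2)B(b,c)) ). -/

import Mathlib

open Real

/-- Dedekind eta function on the imaginary axis: `dedekindEtaI x = η(i x)`
for real `x > 0`, with `q = e^{-2πx}`. -/
noncomputable def dedekindEtaI (x : ℝ) : ℝ :=
  Real.exp (-(π * x) / 12) * ∏' n : ℕ, (1 - Real.exp (-(2 * π * x) * (n + 1)))

noncomputable def A (b c : ℝ) : ℝ := Real.sqrt ((Real.sqrt (b ^ 4 + c ^ 2) + b ^ 2) / 2)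

noncomputable def B (b c : ℝ) : ℝ := Real.sqrt ((Real.sqrt (b ^ 4 + c ^ 2) - b ^ 2) / 2)

/-- The character χ with χ(n)=0 for even n, 1 for n ≡ 1 (mod 4), −1 for n ≡ 3 (mod 4). -/
noncomputable def chi (n : ℕ) : ℝ :=
  if n % 2 = 0 then 0 else if n % 4 = 1 then 1 else -1


open Filter Topology

/-- The finite `q`-Pochhammer product `(1 - q)(1 - q²)⋯(1 - qⁿ)`. -/
noncomputable def qPoch (q : ℝ) (n : ℕ) : ℝ := ∏ i ∈ Finset.range n, (1 - q ^ (i + 1))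

/-- The reciprocal of `qPoch`, extended by zero to negative indices. -/
noncomputable def qPochInv (q : ℝ) : ℤ → ℝ
  | Int.ofNat n => (qPoch q n)⁻¹
  | Int.negSucc _ => 0

lemma qPoch_succ (q : ℝ) (n : ℕ) : qPoch q (n + 1) = qPoch q n * (1 - q ^ (n + 1)) :=
  Finset.prod_range_succ _ _

lemma one_sub_pow_succ_pos {q : ℝ} (h0 : 0 < q) (h1 : q < 1) (n : ℕ) : 0 < 1 - q ^ (n + 1) :=
  sub_pos.2 (pow_lt_one₀ h0.le h1 n.succ_ne_zero)

lemma qPoch_pos {q : ℝ} (h0 : 0 < q) (h1 : q < 1) (n : ℕ) : 0 < qPoch q n :=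
  Finset.prod_pos fun i _ => one_sub_pow_succ_pos h0 h1 i

lemma qPoch_antitone {q : ℝ} (h0 : 0 < q) (h1 : q < 1) : Antitone (qPoch q) :=
  antitone_nat_of_succ_le fun n => by
    rw [qPoch_succ]
    exact mul_le_of_le_one_right (qPoch_pos h0 h1 n).le (by have := pow_pos h0 (n + 1); linarith)

lemma qPochInv_natCast (q : ℝ) (n : ℕ) : qPochInv q (n : ℤ) = (qPoch q n)⁻¹ := rfl

lemma qPochInv_of_neg (q : ℝ) {j : ℤ} (hj : j < 0) : qPochInv q j = 0 := by
  obtain ⟨n, rfl⟩ := Int.eq_negSucc_of_lt_zero hj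
  rfl

lemma qPochInv_sub_one {q : ℝ} (h0 : 0 < q) (h1 : q < 1) (j : ℤ) :
    qPochInv q (j - 1) = (1 - q ^ j) * qPochInv q j := by
  rcases lt_trichotomy j 0 with hj | rfl | hj
  · rw [qPochInv_of_neg q hj, qPochInv_of_neg q (by omega), mul_zero]
  · simp [qPochInv_of_neg q (show (-1 : ℤ) < 0 by norm_num)]
  · obtain ⟨n, rfl⟩ : ∃ n : ℕ, j = ((n + 1 : ℕ) : ℤ) := ⟨(j - 1).toNat, by omega⟩
    rw [show ((n + 1 : ℕ) : ℤ) - 1 = (n : ℤ) by push_cast; ring, qPochInv_natCast,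
      qPochInv_natCast, qPoch_succ, zpow_natCast]
    have := (qPoch_pos h0 h1 n).ne'
    have := (one_sub_pow_succ_pos h0 h1 n).ne'
    field_simp

/-- The coefficients of `(1 - z⁻¹) ∏_{i=1}^N (1 - z qⁱ)(1 - z⁻¹ qⁱ)` as a Laurent polynomial
in `z`. -/
noncomputable def jacobiCoeff (q : ℝ) (N k : ℕ) : ℝ :=
  (-1) ^ k * q ^ (k * (k + 1) / 2) * qPoch q (2 * N + 1) *
    (qPochInv q (N - k) * qPochInv q (N + k + 1))

lemma jacobiCoeff_eq_zero (q : ℝ) {N k : ℕ} (h : N < k) : jacobiCoeff q N k = 0 := by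
  rw [jacobiCoeff, qPochInv_of_neg q (show (N : ℤ) - k < 0 by omega)]
  simp

lemma triangle_succ (k : ℕ) : (k + 1) * (k + 1 + 1) / 2 = k * (k + 1) / 2 + (k + 1) := by
  rw [show (k + 1) * (k + 1 + 1) = k * (k + 1) + (k + 1) * 2 by ring,
    Nat.add_mul_div_right _ _ two_pos]

lemma jacobiCoeff_succ_zero {q : ℝ} (h0 : 0 < q) (h1 : q < 1) (N : ℕ) :
    jacobiCoeff q (N + 1) 0 = (1 + (q ^ (N + 1)) ^ 2) * jacobiCoeff q N 0
      - q ^ (N + 1) * (-jacobiCoeff q N 0 + jacobiCoeff q N 1) := by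
  have r1 := qPochInv_sub_one h0 h1 (N + 1)
  have r2 := qPochInv_sub_one h0 h1 (N + 2)
  have r3 := qPochInv_sub_one h0 h1 N
  rw [show (N : ℤ) + 1 - 1 = N by ring] at r1
  rw [show (N : ℤ) + 2 - 1 = N + 1 by ring] at r2
  have e1 : q ^ ((N : ℤ) + 1) = q ^ N * q := by rw [zpow_add₀ h0.ne']; simp
  have e2 : q ^ ((N : ℤ) + 2) = q ^ N * q ^ 2 := by rw [zpow_add₀ h0.ne']; norm_cast
  have e3 : q ^ (N : ℤ) = q ^ N := zpow_natCast _ _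
  simp only [jacobiCoeff]
  rw [show 2 * (N + 1) + 1 = 2 * N + 1 + 1 + 1 by ring, qPoch_succ, qPoch_succ]
  push_cast
  rw [show (N : ℤ) + 1 - 0 = N + 1 by ring, show (N : ℤ) + 1 + 0 + 1 = N + 2 by ring,
    show (N : ℤ) - 0 = N by ring, show (N : ℤ) + 0 + 1 = N + 1 by ring,
    show (N : ℤ) + 1 + 1 = N + 2 by ring, r3, r1, r2, e1, e2, e3]
  have p1 : q ^ (2 * N + 1 + 1) = (q ^ N) ^ 2 * q ^ 2 := by ring
  have p2 : q ^ (2 * N + 1 + 1 + 1) = (q ^ N) ^ 2 * q ^ 3 := by ring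
  rw [p1, p2, pow_succ q N]
  simp
  ring

lemma jacobiCoeff_succ_succ {q : ℝ} (h0 : 0 < q) (h1 : q < 1) (N k : ℕ) :
    jacobiCoeff q (N + 1) (k + 1) = (1 + (q ^ (N + 1)) ^ 2) * jacobiCoeff q N (k + 1)
      - q ^ (N + 1) * (jacobiCoeff q N k + jacobiCoeff q N (k + 2)) := by
  have r1 := qPochInv_sub_one h0 h1 (N - k)
  have r2 := qPochInv_sub_one h0 h1 (N - k - 1)
  have r3 := qPochInv_sub_one h0 h1 (N + k + 2)
  have r4 := qPochInv_sub_one h0 h1 (N + k + 3)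
  rw [show (N : ℤ) + k + 2 - 1 = N + k + 1 by ring] at r3
  rw [show (N : ℤ) + k + 3 - 1 = N + k + 2 by ring] at r4
  have hq := h0.ne'
  have e1 : q ^ ((N : ℤ) - k) = q ^ N / q ^ k := by rw [zpow_sub₀ hq]; simp
  have e2 : q ^ ((N : ℤ) - k - 1) = q ^ N / q ^ k / q := by
    rw [zpow_sub₀ hq, zpow_sub₀ hq]; simp
  have e3 : q ^ ((N : ℤ) + k + 2) = q ^ N * q ^ k * q ^ 2 := by
    rw [zpow_add₀ hq, zpow_add₀ hq]; norm_cast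
  have e4 : q ^ ((N : ℤ) + k + 3) = q ^ N * q ^ k * q ^ 3 := by
    rw [zpow_add₀ hq, zpow_add₀ hq]; norm_cast
  simp only [jacobiCoeff]
  rw [show 2 * (N + 1) + 1 = 2 * N + 1 + 1 + 1 by ring, qPoch_succ, qPoch_succ,
    triangle_succ (k + 1), triangle_succ k]
  push_cast
  rw [show (N : ℤ) + 1 - (k + 1) = N - k by ring,
    show (N : ℤ) + 1 + (k + 1) + 1 = N + k + 3 by ring,
    show (N : ℤ) - (k + 1) = N - k - 1 by ring,
    show (N : ℤ) + (k + 1) + 1 = N + k + 2 by ring,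
    show (N : ℤ) - (k + 2) = N - k - 1 - 1 by ring,
    show (N : ℤ) + (k + 2) + 1 = N + k + 3 by ring, r2, r1, r3, r4, e1, e2, e3, e4]
  have p1 : q ^ (2 * N + 1 + 1) = (q ^ N) ^ 2 * q ^ 2 := by ring
  have p2 : q ^ (2 * N + 1 + 1 + 1) = (q ^ N) ^ 2 * q ^ 3 := by ring
  rw [p1, p2, pow_succ q N, pow_add q (k * (k + 1) / 2 + (k + 1)) (k + 1 + 1),
    pow_add q (k * (k + 1) / 2) (k + 1), pow_succ q (k + 1), pow_succ q k]
  have hk : q ^ k ≠ 0 := pow_ne_zero _ hq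
  generalize q ^ (k * (k + 1) / 2) = t
  generalize q ^ N = x
  generalize q ^ k = a at *
  field_simp
  ring

lemma sum_odd_mul_neighbours (d : ℕ → ℝ) (M : ℕ) :
    (-d 0 + d 1) + ∑ k ∈ Finset.range M, (2 * ((k + 1 : ℕ) : ℝ) + 1) * (d k + d (k + 2))
      = 2 * (∑ k ∈ Finset.range (M + 1), (2 * (k : ℝ) + 1) * d k)
        - (2 * M + 3) * d M + (2 * M + 1) * d (M + 1) := by
  induction M with
  | zero => simp; ring
  | succ M ih =>
    rw [Finset.sum_range_succ, ← add_assoc, ih, Finset.sum_range_succ _ (M + 1)]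
    push_cast
    ring

lemma sum_odd_mul_jacobiCoeff {q : ℝ} (h0 : 0 < q) (h1 : q < 1) (N M : ℕ) (hM : N < M) :
    ∑ k ∈ Finset.range M, (2 * (k : ℝ) + 1) * jacobiCoeff q N k = qPoch q N ^ 2 := by
  induction N generalizing M with
  | zero =>
    obtain ⟨M, rfl⟩ := Nat.exists_eq_add_of_lt hM
    rw [zero_add, Finset.sum_range_succ', Finset.sum_eq_zero fun k _ => by
      rw [jacobiCoeff_eq_zero q k.succ_pos, mul_zero]]
    have := (qPoch_pos h0 h1 1).ne'
    have hr := qPochInv_natCast q 1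
    have hr0 := qPochInv_natCast q 0
    push_cast at hr hr0
    simp only [jacobiCoeff]
    simp [hr, hr0]
    field_simp
    simp [qPoch]
  | succ N ih =>
    obtain ⟨M, rfl⟩ := Nat.exists_eq_add_of_lt (Nat.zero_lt_of_lt hM)
    rw [zero_add] at *
    have key := sum_odd_mul_neighbours (jacobiCoeff q N) M
    have z1 := jacobiCoeff_eq_zero q (show N < M by omega)
    have z2 := jacobiCoeff_eq_zero q (show N < M + 1 by omega)
    have i1 := ih (M + 1) (by omega)
    rw [i1, z1, z2] at key
    rw [Finset.sum_range_succ'] at i1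
    rw [Finset.sum_range_succ', Finset.sum_congr rfl fun k _ => by
      rw [jacobiCoeff_succ_succ h0 h1 N k, mul_sub, mul_left_comm _ (1 + _ : ℝ),
        mul_left_comm _ (q ^ (N + 1))], Finset.sum_sub_distrib, ← Finset.mul_sum,
      ← Finset.mul_sum, jacobiCoeff_succ_zero h0 h1, qPoch_succ]
    push_cast at *
    linear_combination (1 + (q ^ (N + 1)) ^ 2) * i1 - q ^ (N + 1) * key

lemma summable_pow_succ {q : ℝ} (h0 : 0 < q) (h1 : q < 1) :
    Summable fun n : ℕ => q ^ (n + 1) :=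
  (summable_nat_add_iff 1).2 (summable_geometric_of_lt_one h0.le h1)

lemma tendsto_qPoch {q : ℝ} (h0 : 0 < q) (h1 : q < 1) :
    Tendsto (qPoch q) atTop (𝓝 (∏' n : ℕ, (1 - q ^ (n + 1)))) := by
  have : Multipliable fun n : ℕ => 1 + -q ^ (n + 1) :=
    multipliable_one_add_of_summable (by simpa using (summable_pow_succ h0 h1).abs)
  simp only [← sub_eq_add_neg] at this
  exact this.hasProd.tendsto_prod_nat

lemma tprod_one_sub_pow_pos {q : ℝ} (h0 : 0 < q) (h1 : q < 1) :
    0 < ∏' n : ℕ, (1 - q ^ (n + 1)) := by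
  refine lt_of_le_of_ne (ge_of_tendsto' (tendsto_qPoch h0 h1) fun n => (qPoch_pos h0 h1 n).le)
    (Ne.symm ?_)
  simp only [sub_eq_add_neg]
  refine tprod_one_add_ne_zero_of_summable (f := fun n : ℕ => -q ^ (n + 1)) (fun n => ?_) ?_
  · rw [← sub_eq_add_neg]
    exact (one_sub_pow_succ_pos h0 h1 n).ne'
  · simpa using (summable_pow_succ h0 h1).abs

lemma abs_qPochInv_le {q : ℝ} (h0 : 0 < q) (h1 : q < 1) (j : ℤ) :
    |qPochInv q j| ≤ (∏' n : ℕ, (1 - q ^ (n + 1)))⁻¹ := by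
  have hp := tprod_one_sub_pow_pos h0 h1
  rcases lt_or_ge j 0 with hj | hj
  · rw [qPochInv_of_neg q hj, abs_zero]
    exact (inv_pos.2 hp).le
  · lift j to ℕ using hj
    rw [qPochInv_natCast, abs_of_pos (inv_pos.2 (qPoch_pos h0 h1 j))]
    exact inv_anti₀ hp ((qPoch_antitone h0 h1).le_of_tendsto (tendsto_qPoch h0 h1) j)

lemma tendsto_qPochInv {q : ℝ} (h0 : 0 < q) (h1 : q < 1) :
    Tendsto (qPochInv q) atTop (𝓝 (∏' n : ℕ, (1 - q ^ (n + 1)))⁻¹) := by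
  have ht : Tendsto Int.toNat atTop atTop :=
    tendsto_atTop.2 fun b => (eventually_ge_atTop (b : ℤ)).mono fun a ha => by omega
  have h := ((tendsto_qPoch h0 h1).inv₀ (tprod_one_sub_pow_pos h0 h1).ne').comp ht
  refine h.congr' ?_
  filter_upwards [eventually_ge_atTop 0] with j hj
  lift j to ℕ using hj
  simp [qPochInv_natCast]

lemma summable_odd_mul_pow_triangle {q : ℝ} (h0 : 0 < q) (h1 : q < 1) :
    Summable fun k : ℕ => (2 * (k : ℝ) + 1) * q ^ (k * (k + 1) / 2) := by
  have hs : Summable fun k : ℕ => (2 * (k : ℝ) + 1) * q ^ k := by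
    have := summable_pow_mul_geometric_of_norm_lt_one (R := ℝ) 1
      (show ‖q‖ < 1 by rwa [Real.norm_of_nonneg h0.le])
    have h2 := summable_geometric_of_lt_one h0.le h1
    refine ((this.mul_left 2).add h2).congr fun k => ?_
    ring
  refine hs.of_nonneg_of_le (fun k => by positivity) fun k => ?_
  gcongr ?_ * ?_
  refine pow_le_pow_of_le_one h0.le h1.le ?_
  rw [Nat.le_div_iff_mul_le two_pos]
  rcases k with _ | k
  · simp
  · exact Nat.mul_le_mul_left _ (by omega)

/-- Jacobi's identity for the cube of Euler's product. -/
theorem hasSum_jacobi_cube {q : ℝ} (h0 : 0 < q) (h1 : q < 1) :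
    HasSum (fun k : ℕ => (-1) ^ k * (2 * (k : ℝ) + 1) * q ^ (k * (k + 1) / 2))
      ((∏' n : ℕ, (1 - q ^ (n + 1))) ^ 3) := by
  have hp := tprod_one_sub_pow_pos h0 h1
  have hlim := tendsto_qPoch h0 h1
  set p := ∏' n : ℕ, (1 - q ^ (n + 1))
  have hs := summable_odd_mul_pow_triangle h0 h1
  have hsum : Summable fun k : ℕ => (-1) ^ k * (2 * (k : ℝ) + 1) * q ^ (k * (k + 1) / 2) := by
    refine Summable.of_norm_bounded hs fun k => ?_
    rw [norm_mul, norm_mul, norm_pow, norm_neg, norm_one, one_pow, one_mul,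
      Real.norm_of_nonneg (by positivity), Real.norm_of_nonneg (by positivity)]
  have lim1 : Tendsto (fun N => ∑' k : ℕ, (2 * (k : ℝ) + 1) * jacobiCoeff q N k) atTop
      (𝓝 (p ^ 2)) := by
    refine (hlim.pow 2).congr fun N => ?_
    rw [← sum_odd_mul_jacobiCoeff h0 h1 N (N + 1) N.lt_succ_self, tsum_eq_sum]
    intro k hk
    rw [jacobiCoeff_eq_zero q (by simpa using hk), mul_zero]
  have lim2 : Tendsto (fun N => ∑' k : ℕ, (2 * (k : ℝ) + 1) * jacobiCoeff q N k) atTop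
      (𝓝 (∑' k : ℕ, (-1) ^ k * (2 * (k : ℝ) + 1) * q ^ (k * (k + 1) / 2) * p⁻¹)) := by
    refine tendsto_tsum_of_dominated_convergence (hs.mul_right (p⁻¹ * p⁻¹)) (fun k => ?_)
      (Eventually.of_forall fun N k => ?_)
    · have t1 : Tendsto (fun N : ℕ => qPoch q (2 * N + 1)) atTop (𝓝 p) :=
        hlim.comp (tendsto_atTop_mono (fun N => show N ≤ 2 * N + 1 by omega) tendsto_id)
      have t2 : Tendsto (fun N : ℕ => qPochInv q (N - k)) atTop (𝓝 p⁻¹) :=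
        (tendsto_qPochInv h0 h1).comp
          (tendsto_atTop_add_const_right _ (-(k : ℤ)) tendsto_natCast_atTop_atTop)
      have t3 : Tendsto (fun N : ℕ => qPochInv q (N + k + 1)) atTop (𝓝 p⁻¹) :=
        (tendsto_qPochInv h0 h1).comp (tendsto_atTop_add_const_right _ 1
          (tendsto_atTop_add_const_right _ (k : ℤ) tendsto_natCast_atTop_atTop))
      have := ((t1.const_mul ((-1) ^ k * q ^ (k * (k + 1) / 2))).mul (t2.mul t3)).const_mul
        (2 * (k : ℝ) + 1)
      rw [show (-1) ^ k * (2 * (k : ℝ) + 1) * q ^ (k * (k + 1) / 2) * p⁻¹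
        = (2 * (k : ℝ) + 1) * ((-1) ^ k * q ^ (k * (k + 1) / 2) * p * (p⁻¹ * p⁻¹)) by field_simp]
      exact this
    · have b1 : |qPoch q (2 * N + 1)| ≤ 1 := by
        rw [abs_of_pos (qPoch_pos h0 h1 _)]
        simpa [qPoch] using qPoch_antitone h0 h1 (Nat.zero_le (2 * N + 1))
      rw [jacobiCoeff, norm_mul, norm_mul, norm_mul, norm_mul, norm_mul, norm_pow, norm_neg,
        norm_one, one_pow, one_mul, Real.norm_of_nonneg (by positivity),
        Real.norm_of_nonneg (by positivity), mul_assoc (q ^ _), ← mul_assoc]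
      rw [← one_mul (p⁻¹ * p⁻¹)]
      gcongr
      · exact b1
      · exact abs_qPochInv_le h0 h1 _
      · exact abs_qPochInv_le h0 h1 _
  have heq := tendsto_nhds_unique lim1 lim2
  rw [tsum_mul_right] at heq
  convert hsum.hasSum using 1
  field_simp at heq
  linear_combination heq

lemma dedekindEtaI_cube (x : ℝ) :
    dedekindEtaI (4 * x / π) ^ 3
      = Real.exp (-x) * (∏' n : ℕ, (1 - Real.exp (-8 * x) ^ (n + 1))) ^ 3 := by
  have e1 : ∀ n : ℕ, Real.exp (-(2 * π * (4 * x / π)) * (n + 1)) = Real.exp (-8 * x) ^ (n + 1) := by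
    intro n
    rw [← Real.exp_nat_mul]
    congr 1
    field_simp
    push_cast
    ring
  rw [dedekindEtaI, mul_pow, ← Real.exp_nat_mul]
  simp only [e1]
  congr 2
  push_cast
  field_simp
  ring

/-- The term `m e^{-m² x}` of the theta series. -/
noncomputable def thetaTerm (m x : ℝ) : ℝ := m * Real.exp (-m ^ 2 * x)

lemma hasSum_dedekindEtaI_cube {x : ℝ} (hx : 0 < x) :
    HasSum (fun k : ℕ => (-1) ^ k * thetaTerm (2 * k + 1) x) (dedekindEtaI (4 * x / π) ^ 3) := by
  rw [dedekindEtaI_cube]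
  have h := (hasSum_jacobi_cube (Real.exp_pos (-8 * x))
    (Real.exp_lt_one_iff.2 (by linarith))).mul_left (Real.exp (-x))
  refine h.congr_fun fun k => ?_
  have ht : ((k * (k + 1) / 2 : ℕ) : ℝ) = k * (k + 1) / 2 := by
    rw [Nat.cast_div (Nat.even_mul_succ_self k).two_dvd two_ne_zero]
    push_cast
    rfl
  have he : Real.exp (-(2 * (k : ℝ) + 1) ^ 2 * x)
      = Real.exp (-x) * Real.exp (-8 * x) ^ (k * (k + 1) / 2) := by
    rw [← Real.exp_nat_mul, ← Real.exp_add, ht]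
    congr 1
    ring
  rw [thetaTerm, he]
  ring

lemma hasSum_dedekindEtaI_cube_paired {x : ℝ} (hx : 0 < x) :
    HasSum (fun k : ℕ => thetaTerm (4 * k + 5) x - thetaTerm (4 * k + 3) x)
      (dedekindEtaI (4 * x / π) ^ 3 - thetaTerm 1 x) := by
  have h1 := (hasSum_nat_add_iff' 1).2 (hasSum_dedekindEtaI_cube hx)
  set f : ℕ → ℝ := fun n => (-1) ^ (n + 1) * thetaTerm (2 * ((n + 1 : ℕ) : ℝ) + 1) x with hf
  have he : HasSum (fun k => f (2 * k)) (∑' k, f (2 * k)) :=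
    (h1.summable.comp_injective (mul_right_injective₀ (two_ne_zero' ℕ))).hasSum
  have ho : HasSum (fun k => f (2 * k + 1)) (∑' k, f (2 * k + 1)) :=
    (h1.summable.comp_injective
      ((add_left_injective 1).comp (mul_right_injective₀ (two_ne_zero' ℕ)))).hasSum
  have heq := (HasSum.even_add_odd he ho).unique h1
  have hsum := he.add ho
  rw [heq, Finset.sum_range_one] at hsum
  simp only [Nat.cast_zero, mul_zero, zero_add, pow_zero, one_mul] at hsum
  refine hsum.congr_fun fun k => ?_
  simp only [hf]
  have c1 : 2 * ((2 * k + 1 : ℕ) : ℝ) + 1 = 4 * k + 3 := by push_cast; ring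
  have c2 : 2 * ((2 * k + 1 + 1 : ℕ) : ℝ) + 1 = 4 * k + 5 := by push_cast; ring
  have s1 : (-1 : ℝ) ^ (2 * k + 1) = -1 := by simp [pow_succ, pow_mul]
  have s2 : (-1 : ℝ) ^ (2 * k + 1 + 1) = 1 := by simp [pow_succ, pow_mul]
  rw [c1, c2, s1, s2]
  ring

/-- The partial fraction expansion of the hyperbolic secant. -/
lemma hasSum_sech {w : ℂ} (hw : 0 < w.re) :
    HasSum (fun k : ℕ => ((4 * k + 5) / ((4 * k + 5) ^ 2 + w ^ 2)
        - (4 * k + 3) / ((4 * k + 3) ^ 2 + w ^ 2) : ℂ))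
      (π / 4 / Complex.cosh (π / 2 * w) - 1 / (1 + w ^ 2)) := by
  set z : ℂ := Complex.I * w with hz
  have hzim : z.im = w.re := by simp [hz]
  have hz2 : w ^ 2 = -z ^ 2 := by rw [hz, mul_pow, Complex.I_sq]; ring
  have him : ∀ a : ℂ, 0 < a.im → a ∈ Complex.integerComplement := by
    rintro a ha ⟨n, rfl⟩
    simp at ha
  have hne : ∀ m : ℝ, (m : ℂ) + z ≠ 0 := fun m h => by
    have := congrArg Complex.im h
    simp [hzim] at this
    exact hw.ne' this
  have hne' : ∀ m : ℝ, (m : ℂ) - z ≠ 0 := fun m h => by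
    have := congrArg Complex.im h
    simp [hzim] at this
    exact hw.ne' this
  have hu : (1 + z) / 4 ∈ Complex.integerComplement := him _ (by simp [hzim, hw])
  have hv : (z - 1) / 4 ∈ Complex.integerComplement := him _ (by simp [hzim, hw])
  have su := (summable_cotTerm hu).hasSum
  have sv := (summable_cotTerm hv).hasSum
  have h := (su.sub sv).div_const 8
  have cu := cot_series_rep' hu
  have cv := cot_series_rep' hv
  simp only [cotTerm] at h
  rw [← cu, ← cv] at h
  have hval : π / 4 / Complex.cosh (π / 2 * w) - 1 / (1 + w ^ 2)
      = (π * Complex.cot (π * ((1 + z) / 4)) - 1 / ((1 + z) / 4)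
        - (π * Complex.cot (π * ((z - 1) / 4)) - 1 / ((z - 1) / 4))) / 8 := by
    have a1 := hne 1
    have a2 := hne' 1
    push_cast at a1 a2
    have a3 : z - 1 ≠ 0 := by rw [← neg_sub]; exact neg_ne_zero.2 a2
    have hsu := sin_pi_mul_ne_zero hu
    have hsv := sin_pi_mul_ne_zero hv
    have e : (π : ℂ) * ((z - 1) / 4) = π * ((1 + z) / 4) - π / 2 := by ring
    rw [e, Complex.sin_sub_pi_div_two] at hsv
    have hcos : Complex.cosh (π / 2 * w)
        = 2 * Complex.sin (π * ((1 + z) / 4)) * Complex.cos (π * ((1 + z) / 4)) := by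
      rw [← Complex.sin_two_mul, ← Complex.cos_mul_I,
        show 2 * (π * ((1 + z) / 4)) = π / 2 * w * Complex.I + π / 2 by rw [hz]; ring,
        Complex.sin_add_pi_div_two]
    have hsc := Complex.sin_sq_add_cos_sq (π * ((1 + z) / 4))
    rw [e, Complex.cot_eq_cos_div_sin, Complex.cot_eq_cos_div_sin, Complex.sin_sub_pi_div_two,
      Complex.cos_sub_pi_div_two, hcos, show 1 + w ^ 2 = (1 + z) * (1 - z) by rw [hz2]; ring]
    have hcv := neg_ne_zero.1 hsv
    generalize Complex.sin (π * ((1 + z) / 4)) = S at *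
    generalize Complex.cos (π * ((1 + z) / 4)) = C at *
    have t1 : (π : ℂ) / 4 / (2 * S * C) = (π * (C / S) - π * (S / -C)) / 8 := by
      field_simp
      linear_combination -8 * hsc
    have t2 : 1 / ((1 + z) * (1 - z)) = (1 / ((1 + z) / 4) - 1 / ((z - 1) / 4)) / 8 := by
      field_simp
      ring
    rw [t1, t2]
    ring
  rw [hval]
  refine h.congr_fun fun k => ?_
  have a1 := hne (4 * (k : ℕ) + 5)
  have a2 := hne' (4 * k + 5)
  have a3 := hne (4 * k + 3)
  have a4 := hne' (4 * k + 3)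
  push_cast at a1 a2 a3 a4
  have b1 : (1 + z) / 4 - (k + 1) = -(4 * k + 3 - z) / 4 := by ring
  have b2 : (1 + z) / 4 + (k + 1) = (4 * k + 5 + z) / 4 := by ring
  have b3 : (z - 1) / 4 - (k + 1) = -(4 * k + 5 - z) / 4 := by ring
  have b4 : (z - 1) / 4 + (k + 1) = (4 * k + 3 + z) / 4 := by ring
  have d1 : ((4 * k + 5) ^ 2 + w ^ 2 : ℂ) = (4 * k + 5 + z) * (4 * k + 5 - z) := by
    rw [hz2]; ring
  have d2 : ((4 * k + 3) ^ 2 + w ^ 2 : ℂ) = (4 * k + 3 + z) * (4 * k + 3 - z) := by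
    rw [hz2]; ring
  rw [b1, b2, b3, b4, d1, d2]
  generalize (4 * k + 5 : ℂ) = m at *
  generalize (4 * k + 3 : ℂ) = n at *
  field_simp
  ring

open MeasureTheory

lemma integrableOn_exp_neg_mul {r : ℝ} (hr : 0 < r) :
    IntegrableOn (fun x : ℝ => Real.exp (-r * x)) (Set.Ioi 0) :=
  integrableOn_exp_mul_Ioi (neg_lt_zero.2 hr) 0

lemma integral_exp_neg_mul {r : ℝ} (hr : 0 < r) :
    ∫ x in Set.Ioi (0 : ℝ), Real.exp (-r * x) = 1 / r := by
  rw [integral_exp_mul_Ioi (neg_lt_zero.2 hr) 0]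
  simp

lemma integrableOn_thetaTerm_mul_cexp (m : ℝ) {s : ℂ} (hs : 0 < s.re) :
    IntegrableOn (fun x : ℝ => (thetaTerm m x : ℂ) * Complex.exp (-s * x)) (Set.Ioi 0) := by
  have hre : (-((m : ℂ) ^ 2 + s)).re < 0 := by
    have h : (((m ^ 2 : ℝ) : ℂ)).re = m ^ 2 := Complex.ofReal_re _
    push_cast at h
    rw [Complex.neg_re, Complex.add_re, h]
    nlinarith [sq_nonneg m]
  refine IntegrableOn.congr_fun ((integrableOn_exp_mul_complex_Ioi hre 0).const_mul (m : ℂ))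
    (fun x _ => ?_) measurableSet_Ioi
  simp only [thetaTerm]
  push_cast
  rw [mul_assoc, ← Complex.exp_add]
  ring_nf

lemma integral_thetaTerm_mul_cexp (m : ℝ) {s : ℂ} (hs : 0 < s.re) :
    ∫ x in Set.Ioi (0 : ℝ), (thetaTerm m x : ℂ) * Complex.exp (-s * x) = m / (m ^ 2 + s) := by
  have hre : (-((m : ℂ) ^ 2 + s)).re < 0 := by
    have h : (((m ^ 2 : ℝ) : ℂ)).re = m ^ 2 := Complex.ofReal_re _
    push_cast at h
    rw [Complex.neg_re, Complex.add_re, h]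
    nlinarith [sq_nonneg m]
  have h := integral_exp_mul_complex_Ioi hre 0
  rw [Complex.ofReal_zero, mul_zero, Complex.exp_zero, neg_div_neg_eq] at h
  rw [div_eq_mul_one_div, ← h, ← integral_const_mul]
  congr 1 with x
  simp only [thetaTerm]
  push_cast
  rw [mul_assoc, ← Complex.exp_add]
  ring_nf

lemma abs_thetaTerm_sub_le {m x : ℝ} (hm : 0 < m) (hx : 0 < x) :
    |thetaTerm (m + 2) x - thetaTerm m x|
      ≤ m * Real.exp (-m ^ 2 * x) + (2 - m) * Real.exp (-(m + 2) ^ 2 * x) := by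
  have h : Real.exp (-(m + 2) ^ 2 * x) ≤ Real.exp (-m ^ 2 * x) :=
    Real.exp_le_exp.2 (by nlinarith [mul_pos hm hx])
  have h0 := Real.exp_pos (-(m + 2) ^ 2 * x)
  simp only [thetaTerm]
  rw [abs_le]
  constructor <;> nlinarith

lemma integral_norm_thetaTerm_sub_le {m : ℝ} (hm : 0 < m) {s : ℂ} (hs : 0 < s.re) :
    ∫ x in Set.Ioi (0 : ℝ),
      ‖((thetaTerm (m + 2) x - thetaTerm m x : ℝ) : ℂ) * Complex.exp (-s * x)‖ ≤ 6 / m ^ 2 := by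
  have i1 := (integrableOn_exp_neg_mul (pow_pos hm 2)).const_mul m
  have i2 := (integrableOn_exp_neg_mul (show 0 < (m + 2) ^ 2 by positivity)).const_mul (2 - m)
  calc _ ≤ ∫ x in Set.Ioi (0 : ℝ),
        (m * Real.exp (-m ^ 2 * x) + (2 - m) * Real.exp (-(m + 2) ^ 2 * x)) := by
        refine setIntegral_mono_on ?_ (i1.add i2) measurableSet_Ioi fun x hx => ?_
        · refine Integrable.norm ?_
          refine ((integrableOn_thetaTerm_mul_cexp (m + 2) hs).sub
            (integrableOn_thetaTerm_mul_cexp m hs)).congr_fun (fun x _ => ?_) measurableSet_Ioi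
          simp [sub_mul]
        · rw [norm_mul, Complex.norm_real]
          refine (mul_le_of_le_one_right (norm_nonneg _) ?_).trans (abs_thetaTerm_sub_le hm hx)
          rw [Complex.norm_exp, Real.exp_le_one_iff]
          simpa using (mul_pos hs hx).le
    _ = m * (1 / m ^ 2) + (2 - m) * (1 / (m + 2) ^ 2) := by
        rw [integral_add i1 i2, integral_const_mul, integral_const_mul,
          integral_exp_neg_mul (pow_pos hm 2), integral_exp_neg_mul (by positivity)]
    _ ≤ 6 / m ^ 2 := by
        have : 6 / m ^ 2 - (m * (1 / m ^ 2) + (2 - m) * (1 / (m + 2) ^ 2))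
            = (20 * m + 24) / (m ^ 2 * (m + 2) ^ 2) := by
          field_simp
          ring
        have : 0 ≤ (20 * m + 24) / (m ^ 2 * (m + 2) ^ 2) := by positivity
        linarith

/-- The theta series of `η³`, with its terms of index `2k + 1` and `2k + 2` grouped together. -/
noncomputable def pairedThetaTerm : ℕ → ℝ → ℝ
  | 0, x => thetaTerm 1 x
  | k + 1, x => thetaTerm (4 * k + 5) x - thetaTerm (4 * k + 3) x

lemma hasSum_pairedThetaTerm {x : ℝ} (hx : 0 < x) :
    HasSum (fun k => pairedThetaTerm k x) (dedekindEtaI (4 * x / π) ^ 3) := by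
  refine (hasSum_nat_add_iff' 1).1 ?_
  rw [Finset.sum_range_one]
  exact hasSum_dedekindEtaI_cube_paired hx

lemma integrableOn_pairedThetaTerm_mul_cexp (k : ℕ) {s : ℂ} (hs : 0 < s.re) :
    IntegrableOn (fun x : ℝ => (pairedThetaTerm k x : ℂ) * Complex.exp (-s * x)) (Set.Ioi 0) := by
  rcases k with _ | k
  · exact integrableOn_thetaTerm_mul_cexp 1 hs
  · refine IntegrableOn.congr_fun ((integrableOn_thetaTerm_mul_cexp (4 * k + 5) hs).sub
      (integrableOn_thetaTerm_mul_cexp (4 * k + 3) hs)) (fun x _ => ?_) measurableSet_Ioi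
    simp [pairedThetaTerm, sub_mul]

lemma summable_integral_norm_pairedThetaTerm {s : ℂ} (hs : 0 < s.re) :
    Summable fun k => ∫ x in Set.Ioi (0 : ℝ),
      ‖(pairedThetaTerm k x : ℂ) * Complex.exp (-s * x)‖ := by
  refine (summable_nat_add_iff 1).1 ?_
  have hbase : Summable fun k : ℕ => 6 * (1 / ((k + 1 : ℕ) : ℝ) ^ 2) :=
    ((summable_nat_add_iff 1).2 (Real.summable_one_div_nat_pow.2 one_lt_two)).mul_left 6
  refine hbase.of_nonneg_of_le (fun k => integral_nonneg fun x => norm_nonneg _) fun k => ?_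
  have h := integral_norm_thetaTerm_sub_le (show (0 : ℝ) < 4 * k + 3 by positivity) hs
  rw [show (4 * k + 3 + 2 : ℝ) = 4 * k + 5 by ring] at h
  refine h.trans ?_
  rw [div_eq_mul_one_div]
  push_cast
  have hk : (k : ℝ) + 1 ≤ 4 * k + 3 := by linarith [(Nat.cast_nonneg k : (0 : ℝ) ≤ k)]
  gcongr

lemma hasSum_integral_pairedThetaTerm {w : ℂ} (hw : 0 < w.re) (hw2 : 0 < (w ^ 2).re) :
    HasSum (fun k => ∫ x in Set.Ioi (0 : ℝ),
      (pairedThetaTerm k x : ℂ) * Complex.exp (-w ^ 2 * x))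
      (π / 4 / Complex.cosh (π / 2 * w)) := by
  refine (hasSum_nat_add_iff' 1).1 ?_
  have h0 := integral_thetaTerm_mul_cexp 1 hw2
  rw [Complex.ofReal_one, one_pow] at h0
  rw [Finset.sum_range_one]
  simp only [pairedThetaTerm]
  rw [h0]
  refine (hasSum_sech hw).congr_fun fun k => ?_
  have h3 := integral_thetaTerm_mul_cexp (4 * k + 3) hw2
  have h5 := integral_thetaTerm_mul_cexp (4 * k + 5) hw2
  push_cast at h3 h5
  rw [← h3, ← h5, ← integral_sub (integrableOn_thetaTerm_mul_cexp _ hw2)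
    (integrableOn_thetaTerm_mul_cexp _ hw2)]
  simp only [Complex.ofReal_sub, sub_mul]

/-- The real part of the Laplace transform of `η³(i·4x/π)` at `w²`. -/
theorem integral_dedekindEtaI_cube_mul_re_cexp {w : ℂ} (hw : 0 < w.re) (hw2 : 0 < (w ^ 2).re) :
    ∫ x in Set.Ioi (0 : ℝ), dedekindEtaI (4 * x / π) ^ 3 * (Complex.exp (-w ^ 2 * x)).re
      = (π / 4 / Complex.cosh (π / 2 * w)).re := by
  have hint := fun k => integrableOn_pairedThetaTerm_mul_cexp k hw2
  have hre := fun k => (hint k).re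
  have h := hasSum_integral_of_summable_integral_norm hre
    ((summable_integral_norm_pairedThetaTerm hw2).of_nonneg_of_le
      (fun k => integral_nonneg fun x => norm_nonneg _)
      fun k => integral_mono (hre k).norm (hint k).norm fun x => RCLike.norm_re_le_norm _)
  have h' := Complex.hasSum_re (hasSum_integral_pairedThetaTerm hw hw2)
  refine Eq.trans ?_ (h'.unique (h.congr_fun fun k => (integral_re (hint k)).symm)).symm
  refine setIntegral_congr_fun measurableSet_Ioi fun x hx => ?_
  simp only [RCLike.re_to_complex, Complex.re_ofReal_mul]
  exact ((hasSum_pairedThetaTerm hx).mul_right _).tsum_eq.symm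

lemma A_pos {b : ℝ} (c : ℝ) (hb : 0 < b) : 0 < A b c := by
  unfold A
  positivity

lemma A_sq (b c : ℝ) : A b c ^ 2 = (√(b ^ 4 + c ^ 2) + b ^ 2) / 2 :=
  Real.sq_sqrt (by positivity)

lemma sq_le_sqrt_pow_four_add_sq (b c : ℝ) : b ^ 2 ≤ √(b ^ 4 + c ^ 2) :=
  Real.le_sqrt_of_sq_le (by nlinarith [sq_nonneg c])

lemma B_sq (b c : ℝ) : B b c ^ 2 = (√(b ^ 4 + c ^ 2) - b ^ 2) / 2 :=
  Real.sq_sqrt (by linarith [sq_le_sqrt_pow_four_add_sq b c])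

lemma two_mul_A_mul_B (b : ℝ) {c : ℝ} (hc : 0 < c) : 2 * A b c * B b c = c := by
  have hA : 0 ≤ A b c := Real.sqrt_nonneg _
  have hB : 0 ≤ B b c := Real.sqrt_nonneg _
  refine (sq_eq_sq₀ (by positivity) hc.le).1 ?_
  rw [mul_pow, mul_pow, A_sq, B_sq]
  linear_combination Real.sq_sqrt (show 0 ≤ b ^ 4 + c ^ 2 by positivity)

lemma A_add_B_mul_I_sq (b : ℝ) {c : ℝ} (hc : 0 < c) :
    ((A b c : ℂ) + B b c * Complex.I) ^ 2 = (b ^ 2 : ℝ) + c * Complex.I := by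
  have h1 : A b c ^ 2 - B b c ^ 2 = b ^ 2 := by rw [A_sq, B_sq]; ring
  have h2 : (2 * A b c * B b c : ℂ) = c := by exact_mod_cast two_mul_A_mul_B b hc
  rw [← h1]
  push_cast
  linear_combination (B b c : ℂ) ^ 2 * Complex.I_sq + Complex.I * h2

lemma re_div_cosh (r u v : ℝ) :
    ((r : ℂ) / Complex.cosh (u + v * Complex.I)).re
      = r * (Real.cosh u * Real.cos v / (Real.cosh u ^ 2 - Real.sin v ^ 2)) := by
  have h : Complex.cosh (u + v * Complex.I)
      = (Real.cosh u * Real.cos v : ℝ) + (Real.sinh u * Real.sin v : ℝ) * Complex.I := by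
    rw [Complex.cosh_add, Complex.cosh_mul_I, Complex.sinh_mul_I]
    push_cast
    ring
  have hn : Complex.normSq ((Real.cosh u * Real.cos v : ℝ)
      + (Real.sinh u * Real.sin v : ℝ) * Complex.I) = Real.cosh u ^ 2 - Real.sin v ^ 2 := by
    rw [Complex.normSq_add_mul_I, mul_pow, mul_pow, Real.sinh_sq, Real.cos_sq']
    ring
  rw [h, Complex.div_re, hn]
  simp only [Complex.add_re, Complex.mul_re, Complex.ofReal_re, Complex.ofReal_im, Complex.I_re,
    Complex.I_im]
  ring

theorem glasser_eta3_cos (b c : ℝ) (hb : 0 < b) (hc : 0 < c) :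
    ∫ x in Set.Ioi (0 : ℝ),
        (dedekindEtaI (4 * x / π)) ^ 3 * Real.exp (-(b ^ 2) * x) * Real.cos (c * x)
      = (π / 4) *
          ((Real.cosh (π / 2 * A b c) * Real.cos (π / 2 * B b c)) /
            ((Real.cosh (π / 2 * A b c)) ^ 2 - (Real.sin (π / 2 * B b c)) ^ 2)) := by
  set w : ℂ := (A b c : ℂ) + B b c * Complex.I with hw
  have hwsq := A_add_B_mul_I_sq b hc
  rw [← hw] at hwsq
  have h := integral_dedekindEtaI_cube_mul_re_cexp (w := w) (by simpa [hw] using A_pos c hb)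
    (by rw [hwsq]; simpa [-Complex.ofReal_pow] using pow_pos hb 2)
  have hr := re_div_cosh (π / 4) (π / 2 * A b c) (π / 2 * B b c)
  push_cast at hr
  rw [show (π : ℂ) / 2 * A b c + π / 2 * B b c * Complex.I = π / 2 * w by rw [hw]; ring] at hr
  rw [← hr, ← h]
  refine setIntegral_congr_fun measurableSet_Ioi fun x _ => ?_
  have he : (Complex.exp (-w ^ 2 * x)).re = Real.exp (-(b ^ 2) * x) * Real.cos (c * x) := by
    rw [hwsq, Complex.exp_re]
    simp [-Complex.ofReal_pow]
  simp only [he]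
  ring
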